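/- arXiv:2409.17753 — 2 statements merged into one kernel-verified Lean document; each statement's English description precedes it below -/
import Mathlib

section
/- Let X be an M×M Hermitian positive definite complex matrix. Then the function Y ↦ log det(Y) − Re(tr(Y·X)) + M, defined on Hermitian positive definite M×M complex matrices, attains the value log det(X⁻¹) at Y = X⁻¹, and for every Hermitian positive definite Y with Y ≠ X⁻¹ the value is strictly less than log det(X⁻¹); in particular Y = X⁻¹ is the unique maximizer. -/
open Matrix
open scoped ComplexOrder

open scoped MatrixOrder in
/-- A positive definite matrix factors as `Bᴴ * B` with `B` invertible. -/
theorem Matrix.PosDef.exists_isUnit_eq_conjTranspose_mul_self {n 𝕜 : Type*} [Fintype n]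
    [DecidableEq n] [RCLike 𝕜] {A : Matrix n n 𝕜} (hA : A.PosDef) :
    ∃ B : Matrix n n 𝕜, IsUnit B ∧ A = Bᴴ * B :=
  CStarAlgebra.isStrictlyPositive_iff_eq_star_mul_self.mp hA.isStrictlyPositive

/-- A Hermitian matrix all of whose eigenvalues are `1` is the identity. -/
theorem Matrix.IsHermitian.eq_one_of_eigenvalues_eq_one {n 𝕜 : Type*} [Fintype n]
    [DecidableEq n] [RCLike 𝕜] {A : Matrix n n 𝕜} (hA : A.IsHermitian)
    (h : ∀ i, hA.eigenvalues i = 1) : A = 1 := by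
  have hd : diagonal (RCLike.ofReal ∘ hA.eigenvalues) = (1 : Matrix n n 𝕜) := by
    rw [← diagonal_one]
    congr 1
    ext i
    simp [h i]
  rw [hA.spectral_theorem, hd, map_one]

theorem Matrix.PosDef.log_det_lt_trace_sub_card {n : Type*} [Fintype n] [DecidableEq n]
    {A : Matrix n n ℂ} (hA : A.PosDef) (hne : A ≠ 1) :
    Real.log A.det.re < A.trace.re - Fintype.card n := by
  have hpos := hA.eigenvalues_pos
  have hdet : A.det.re = ∏ i, hA.1.eigenvalues i := by
    have h := hA.1.det_eq_prod_eigenvalues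
    rw [h]
    exact_mod_cast Complex.ofReal_re _
  have htr : A.trace.re = ∑ i, hA.1.eigenvalues i := by
    rw [hA.1.trace_eq_sum_eigenvalues]
    exact_mod_cast Complex.ofReal_re _
  obtain ⟨i, hi⟩ : ∃ i, hA.1.eigenvalues i ≠ 1 := by
    by_contra! h
    exact hne (hA.1.eq_one_of_eigenvalues_eq_one h)
  calc Real.log A.det.re = ∑ i, Real.log (hA.1.eigenvalues i) := by
        rw [hdet, Real.log_prod fun i _ => (hpos i).ne']
    _ < ∑ i, (hA.1.eigenvalues i - 1) :=
        Finset.sum_lt_sum (fun j _ => Real.log_le_sub_one_of_pos (hpos j))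
          ⟨i, Finset.mem_univ i, Real.log_lt_sub_one_of_pos (hpos i) hi⟩
    _ = A.trace.re - Fintype.card n := by simp [htr]

/-- The function `Y ↦ log det Y − Re (tr (Y X)) + M` on Hermitian positive definite
matrices attains the value `log det (X⁻¹)` at `Y = X⁻¹`, and is strictly smaller at
any other Hermitian positive definite `Y`; in particular `Y = X⁻¹` is the unique
maximizer. -/
theorem logDet_variational_unique_maximizer {M : ℕ}
    (X : Matrix (Fin M) (Fin M) ℂ) (hX : X.PosDef) :
    (Real.log ((X⁻¹).det).re - ((X⁻¹ * X).trace).re + M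
        = Real.log ((X⁻¹).det).re) ∧
    ∀ Y : Matrix (Fin M) (Fin M) ℂ, Y.PosDef → Y ≠ X⁻¹ →
      Real.log (Y.det).re - ((Y * X).trace).re + M
        < Real.log ((X⁻¹).det).re := by
  have hXu : IsUnit X.det := hX.det_pos.ne'.isUnit
  refine ⟨by simp [nonsing_inv_mul X hXu], fun Y hY hne => ?_⟩
  obtain ⟨B, hB, hXB⟩ := hX.exists_isUnit_eq_conjTranspose_mul_self
  have hA : (B * Y * Bᴴ).PosDef :=
    hY.mul_mul_conjTranspose_same (vecMul_injective_of_isUnit hB)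
  have hA_ne : B * Y * Bᴴ ≠ 1 := fun h => hne <| by
    rw [mul_assoc, mul_eq_one_comm, mul_assoc, ← hXB] at h
    exact (inv_eq_left_inv h).symm
  have htr : (B * Y * Bᴴ).trace = (Y * X).trace := by
    rw [mul_assoc, trace_mul_comm, mul_assoc, ← hXB]
  have hdet : (B * Y * Bᴴ).det = Y.det * X.det := by
    rw [hXB]
    simp only [det_mul]
    ring
  obtain ⟨hXre, hXim⟩ := Complex.pos_iff.mp hX.det_pos
  obtain ⟨hYre, -⟩ := Complex.pos_iff.mp hY.det_pos
  have hinv : (X⁻¹).det.re = (X.det.re)⁻¹ := by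
    rw [det_nonsing_inv, Ring.inverse_eq_inv', Complex.inv_re, Complex.normSq_apply, ← hXim]
    field_simp
    ring
  have key := hA.log_det_lt_trace_sub_card hA_ne
  rw [htr, hdet, Complex.mul_re, ← hXim, mul_zero, sub_zero,
    Real.log_mul hYre.ne' hXre.ne', Fintype.card_fin] at key
  rw [hinv, Real.log_inv]
  linarith
end

section
/- Let N ≥ 1, and for each n ∈ {1,…,N} let K_n be an M×M Hermitian positive semidefinite complex matrix, D_n an M×M Hermitian positive definite complex matrix, Y_n an M×M Hermitian positive definite complex matrix, a_n ≥ 0 a real number, and C_n > 0 a real number. If R_upp(D_n, Y_n) ≤ a_n·C_n holds for all n, then, setting Y'_n = (K_n + D_n)⁻¹, also R_upp(D_n, Y'_n) ≤ a_n·C_n holds for all n, where R_upp(D,Y) = −log det(D) − log det(Y) + Re(tr(Y·(K_n + D))) − M (with the covariance K_n of the corresponding radar). -/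
open Matrix
open scoped ComplexOrder

section LogDet

variable {𝕜 ι : Type*} [RCLike 𝕜] [Fintype ι] [DecidableEq ι]

theorem Matrix.PosDef.re_det_pos {A : Matrix ι ι 𝕜} (hA : A.PosDef) : 0 < RCLike.re A.det :=
  (RCLike.pos_iff.mp hA.det_pos).1

theorem Matrix.PosDef.re_det_mul {A B : Matrix ι ι 𝕜} (hA : A.PosDef) :
    RCLike.re (A * B).det = RCLike.re A.det * RCLike.re B.det := by
  rw [det_mul, RCLike.mul_re, (RCLike.pos_iff.mp hA.det_pos).2, zero_mul, sub_zero]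

/-- The inequality `log det A ≤ tr A - n` for a positive definite matrix of size `n`. -/
theorem Matrix.PosDef.log_re_det_le {A : Matrix ι ι 𝕜} (hA : A.PosDef) :
    Real.log (RCLike.re A.det) ≤ RCLike.re A.trace - Fintype.card ι := by
  have hdet : RCLike.re A.det = ∏ i, hA.1.eigenvalues i := by
    rw [hA.1.det_eq_prod_eigenvalues, ← RCLike.ofReal_prod, RCLike.ofReal_re]
  have htrace : RCLike.re A.trace = ∑ i, hA.1.eigenvalues i := by
    rw [hA.1.trace_eq_sum_eigenvalues, ← RCLike.ofReal_sum, RCLike.ofReal_re]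
  rw [hdet, htrace, Real.log_prod fun i _ => (hA.eigenvalues_pos i).ne']
  calc ∑ i, Real.log (hA.1.eigenvalues i)
      ≤ ∑ i, (hA.1.eigenvalues i - 1) :=
        Finset.sum_le_sum fun i _ => Real.log_le_sub_one_of_pos (hA.eigenvalues_pos i)
    _ = ∑ i, hA.1.eigenvalues i - Fintype.card ι := by simp

open scoped MatrixOrder in
/-- The inequality `log det (A * B) ≤ tr (A * B) - n` for positive definite matrices of size `n`. -/
theorem Matrix.PosDef.log_re_det_mul_le {A B : Matrix ι ι 𝕜} (hA : A.PosDef) (hB : B.PosDef) :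
    Real.log (RCLike.re (A * B).det) ≤ RCLike.re (A * B).trace - Fintype.card ι := by
  obtain ⟨S, hS⟩ := CStarAlgebra.nonneg_iff_eq_star_mul_self.mp hA.posSemidef.nonneg
  have hdet : (S * B * Sᴴ).det = (A * B).det := by
    rw [hS, star_eq_conjTranspose, mul_assoc, det_mul_comm, mul_assoc, det_mul_comm, mul_assoc]
  have htrace : (S * B * Sᴴ).trace = (A * B).trace := by
    rw [hS, star_eq_conjTranspose, trace_mul_comm, mul_assoc]
  have hP : (S * B * Sᴴ).PosDef := by
    refine (hB.posSemidef.mul_mul_conjTranspose_same S).posDef_iff_det_ne_zero.mpr ?_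
    rw [hdet, det_mul]
    exact mul_ne_zero hA.det_pos.ne' hB.det_pos.ne'
  simpa only [hdet, htrace] using hP.log_re_det_le

end LogDet

/-- Feasibility preservation in the alternating optimization: if the rate upper bounds
`R_upp(D_n, Y_n) ≤ a_n C_n` hold for all radars `n`, then after the update
`Y'_n = (K_n + D_n)⁻¹` the constraints `R_upp(D_n, Y'_n) ≤ a_n C_n` still hold. -/
theorem rate_upp_update_preserves_feasibility {N M : ℕ} (hN : 1 ≤ N)
    (K : Fin N → Matrix (Fin M) (Fin M) ℂ) (hK : ∀ n, (K n).PosSemidef)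
    (D : Fin N → Matrix (Fin M) (Fin M) ℂ) (hD : ∀ n, (D n).PosDef)
    (Y : Fin N → Matrix (Fin M) (Fin M) ℂ) (hY : ∀ n, (Y n).PosDef)
    (a : Fin N → ℝ) (ha : ∀ n, 0 ≤ a n)
    (C : Fin N → ℝ) (hC : ∀ n, 0 < C n)
    (hfeas : ∀ n, -Real.log ((D n).det).re - Real.log ((Y n).det).re
        + ((Y n * (K n + D n)).trace).re - M ≤ a n * C n) :
    ∀ n, -Real.log ((D n).det).re - Real.log (((K n + D n)⁻¹).det).re
        + (((K n + D n)⁻¹ * (K n + D n)).trace).re - M ≤ a n * C n := by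
  intro n
  have hA : (K n + D n).PosDef := (hD n).posSemidef_add (hK n)
  have hlog := (hY n).log_re_det_mul_le hA
  rw [(hY n).re_det_mul, Real.log_mul (hY n).re_det_pos.ne' hA.re_det_pos.ne',
    Fintype.card_fin] at hlog
  have hinv : (K n + D n)⁻¹ * (K n + D n) = 1 :=
    nonsing_inv_mul _ ((isUnit_iff_isUnit_det _).mp hA.isUnit)
  have hdet : (K n + D n)⁻¹.det.re * (K n + D n).det.re = 1 := by
    have h := hA.inv.re_det_mul (B := K n + D n)
    rw [hinv, det_one, RCLike.one_re] at h
    exact h.symm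
  have htrace : ((1 : Matrix (Fin M) (Fin M) ℂ).trace).re = M := by simp
  rw [hinv, htrace, eq_inv_of_mul_eq_one_left hdet, Real.log_inv]
  have := hfeas n
  simp only [RCLike.re_eq_complex_re] at hlog
  linarith
end
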